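/- arXiv:0904.1049 — 2 statements merged into one kernel-verified Lean document; each statement's English description precedes it below -/
import Mathlib

section
/- For positive numbers s ≠ t and a nonnegative integer i, the inequality ψ^(i)(L(s,t)) ≤ (1/(t-s))·∫ₛᵗ ψ^(i)(u) du holds when i is zero or an odd positive integer, and the reversed inequality holds when i is a positive even integer, where L(s,t) is the logarithmic mean. -/
noncomputable def psi (x : ℝ) : ℝ := deriv (fun t => Real.log (Real.Gamma t)) x

noncomputable def polygamma (k : ℕ) : ℝ → ℝ := iteratedDeriv k psi

noncomputable def hz (m : ℕ) (x : ℝ) : ℝ := ∑' k : ℕ, ((x + k) ^ m)⁻¹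

lemma term_bound (m : ℕ) (hm : 1 ≤ m) (y : ℝ) (hy : 0 < y) :
    ((y + 1) ^ (m + 1))⁻¹ ≤ (1 / m) * ((y ^ m)⁻¹ - ((y + 1) ^ m)⁻¹) := by
  have hm' : (0 : ℝ) < m := by exact_mod_cast hm
  have h1 : 1 + (m : ℝ) * (1 / y) ≤ (1 + 1 / y) ^ m :=
    one_add_mul_le_pow (by have : 0 < 1 / y := by positivity
                           linarith) m
  have h2 : (1 + 1 / y) ^ m = (y + 1) ^ m / y ^ m := by
    rw [← div_pow]; congr 1; field_simp
  have h3 : (m : ℝ) * (1 / (y + 1)) ≤ m * (1 / y) := by gcongr; linarith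
  have h4 : (m : ℝ) * (1 / (y + 1)) ≤ (y + 1) ^ m / y ^ m - 1 := by linarith
  have h5 : ((y + 1) ^ (m + 1))⁻¹ = (1 / m) * ((m * (1 / (y + 1))) * ((y + 1) ^ m)⁻¹) := by
    field_simp
    ring
  have h6 : (y ^ m)⁻¹ - ((y + 1) ^ m)⁻¹ = ((y + 1) ^ m / y ^ m - 1) * ((y + 1) ^ m)⁻¹ := by
    field_simp
  rw [h5, h6]
  gcongr

lemma partial_bound (m : ℕ) (hm : 1 ≤ m) (x : ℝ) (hx : 0 < x) (N : ℕ) :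
    ∑ k ∈ Finset.range N, ((x + 1 + k) ^ (m + 1))⁻¹ ≤ (1 / m) * (x ^ m)⁻¹ := by
  have hm' : (0 : ℝ) < m := by exact_mod_cast hm
  have : ∑ k ∈ Finset.range N, ((x + 1 + k) ^ (m + 1))⁻¹
      ≤ (1 / m) * ((x ^ m)⁻¹ - ((x + N) ^ m)⁻¹) := by
    induction N with
    | zero => simp
    | succ n ih =>
      rw [Finset.sum_range_succ]
      have := term_bound m hm (x + n) (by positivity)
      push_cast
      rw [show x + 1 + (n : ℝ) = x + n + 1 by ring, show x + ((n : ℝ) + 1) = x + n + 1 by ring]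
      rw [mul_sub] at *
      linarith
  refine this.trans ?_
  gcongr
  have : 0 < ((x + N) ^ m)⁻¹ := by positivity
  linarith

lemma hz_summable (m : ℕ) (hm : 2 ≤ m) (x : ℝ) (hx : 0 < x) :
    Summable (fun k : ℕ => ((x + k) ^ m)⁻¹) := by
  obtain ⟨n, rfl⟩ : ∃ n, m = n + 1 := ⟨m - 1, by omega⟩
  rw [← summable_nat_add_iff 1]
  have := summable_of_sum_range_le (f := fun k : ℕ => ((x + 1 + k) ^ (n + 1))⁻¹)
    (fun k => by positivity) (partial_bound n (by omega) x hx)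
  refine this.congr fun k => ?_
  push_cast
  congr 2
  ring

lemma hz_bound (m : ℕ) (hm : 1 ≤ m) (x : ℝ) (hx : 0 < x) :
    hz (m + 1) (x + 1) ≤ (1 / m) * (x ^ m)⁻¹ :=
  Real.tsum_le_of_sum_range_le (fun k => by positivity) (partial_bound m hm x hx)

lemma hz_shift (m : ℕ) (hm : 2 ≤ m) (x : ℝ) (hx : 0 < x) :
    hz m x = (x ^ m)⁻¹ + hz m (x + 1) := by
  unfold hz
  rw [(hz_summable m hm x hx).tsum_eq_zero_add]
  simp only [Nat.cast_zero, add_zero, Nat.cast_add, Nat.cast_one]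
  congr 2
  ext k
  congr 2
  ring

lemma hz_nonneg (m : ℕ) (x : ℝ) (hx : 0 < x) : 0 ≤ hz m x :=
  tsum_nonneg fun k => by positivity

lemma inv_pow_hasDerivAt (m : ℕ) (k : ℕ) (y : ℝ) (hy : 0 < y) :
    HasDerivAt (fun y : ℝ => ((y + k) ^ m)⁻¹) (-(m : ℝ) * ((y + k) ^ (m + 1))⁻¹) y := by
  have h0 : y + k ≠ 0 := by positivity
  have h := (((hasDerivAt_id y).add_const (k : ℝ)).pow m).inv (pow_ne_zero m h0)
  refine h.congr_deriv ?_
  simp only [id]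
  rcases m with _ | n
  · simp
  · simp only [Nat.add_sub_cancel]
    field_simp
    simp [Pi.pow_apply]
    ring

lemma hz_hasDerivAt (m : ℕ) (hm : 2 ≤ m) (x : ℝ) (hx : 0 < x) :
    HasDerivAt (hz m) (-(m : ℝ) * hz (m + 1) x) x := by
  have hx2 : 0 < x / 2 := by linarith
  have := hasDerivAt_tsum_of_isPreconnected
    (u := fun k : ℕ => m * ((x / 2 + k) ^ (m + 1))⁻¹)
    (g := fun (k : ℕ) (y : ℝ) => ((y + k) ^ m)⁻¹)
    (g' := fun (k : ℕ) (y : ℝ) => -(m : ℝ) * ((y + k) ^ (m + 1))⁻¹)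
    (t := Set.Ioi (x / 2)) (y₀ := x) (y := x)
    ((hz_summable (m + 1) (by omega) _ hx2).mul_left _) isOpen_Ioi isPreconnected_Ioi
    (fun k y hy => inv_pow_hasDerivAt m k y (hx2.trans hy))
    (fun k y hy => by
      have hy' : x / 2 < y := hy
      have : 0 < y := hx2.trans hy
      rw [norm_mul, norm_neg, Real.norm_of_nonneg (by positivity),
        Real.norm_of_nonneg (by positivity)]
      gcongr)
    (by simp; linarith) (hz_summable m hm x hx) (by simp; linarith)
  rw [tsum_mul_left] at this
  exact this

lemma hz_ineq (m : ℕ) (hm : 3 ≤ m) (x : ℝ) (hx : 0 < x) :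
    2 * hz m x ≤ m * x * hz (m + 1) x := by
  have hm' : (3 : ℝ) ≤ m := by exact_mod_cast hm
  have step : ∀ y : ℝ, 0 < y →
      m * (y + 1) * hz (m + 1) (y + 1) - 2 * hz m (y + 1) ≤ m * y * hz (m + 1) y - 2 * hz m y := by
    intro y hy
    have b := hz_bound m (by omega) y hy
    have b' : m * hz (m + 1) (y + 1) ≤ (y ^ m)⁻¹ := by
      calc _ ≤ m * ((1 / m) * (y ^ m)⁻¹) := by gcongr
        _ = _ := by field_simp
    rw [hz_shift m (by omega) y hy, hz_shift (m + 1) (by omega) y hy]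
    have e : m * y * (y ^ (m + 1))⁻¹ = m * (y ^ m)⁻¹ := by
      field_simp
      ring
    have p : 0 < (y ^ m)⁻¹ := by positivity
    nlinarith
  have it : ∀ N : ℕ, m * (x + N) * hz (m + 1) (x + N) - 2 * hz m (x + N)
      ≤ m * x * hz (m + 1) x - 2 * hz m x := by
    intro N
    induction N with
    | zero => simp
    | succ n ih =>
      refine le_trans ?_ ih
      have := step (x + n) (by positivity)
      push_cast
      rwa [← add_assoc]
  have low : ∀ N : ℕ, -(2 * (1 / ((N : ℝ) + 1))) ≤ m * x * hz (m + 1) x - 2 * hz m x := by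
    intro N
    refine le_trans ?_ (it (N + 2))
    have h1 : 0 ≤ m * (x + (N + 2 : ℕ)) * hz (m + 1) (x + (N + 2 : ℕ)) :=
      mul_nonneg (by positivity) (hz_nonneg _ _ (by positivity))
    obtain ⟨n, rfl⟩ : ∃ n, m = n + 1 := ⟨m - 1, by omega⟩
    have h2 := hz_bound n (by omega) (x + N + 1) (by positivity)
    have h3 : (1 / n : ℝ) * ((x + N + 1) ^ n)⁻¹ ≤ 1 * (1 / (N + 1)) := by
      have : (1 : ℝ) ≤ n := by exact_mod_cast (by omega : 1 ≤ n)
      have h4 : (N : ℝ) + 1 ≤ (x + N + 1) ^ n :=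
        calc (N : ℝ) + 1 ≤ (x + N + 1) := by linarith
          _ ≤ _ := le_self_pow₀ (by have : (0 : ℝ) ≤ N := by positivity
                                    linarith) (by omega)
      rw [← one_div]
      gcongr
      rw [div_le_one (by linarith)]; exact this
    have e : x + ((N + 2 : ℕ) : ℝ) = x + N + 1 + 1 := by push_cast; ring
    rw [e] at h1 ⊢
    linarith
  have lim : Filter.Tendsto (fun N : ℕ => -(2 * (1 / ((N : ℝ) + 1)))) Filter.atTop (nhds 0) := by
    simpa using (tendsto_one_div_add_atTop_nhds_zero_nat (𝕜 := ℝ)).const_mul 2 |>.neg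
  have := le_of_tendsto' lim low
  linarith

lemma hz_antitone (m : ℕ) (hm : 3 ≤ m) :
    AntitoneOn (fun x : ℝ => x ^ 2 * hz m x) (Set.Ioi 0) := by
  have hd : ∀ x : ℝ, 0 < x → HasDerivAt (fun x : ℝ => x ^ 2 * hz m x)
      (x * (2 * hz m x - m * x * hz (m + 1) x)) x := by
    intro x hx
    refine ((hasDerivAt_pow 2 x).mul (hz_hasDerivAt m (by omega) x hx)).congr_deriv ?_
    push_cast; ring
  refine antitoneOn_of_deriv_nonpos (convex_Ioi 0)
    (fun x hx => (hd x hx).continuousAt.continuousWithinAt)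
    (fun x hx => (hd x (by simpa using hx)).differentiableAt.differentiableWithinAt) ?_
  intro x hx
  have hx : 0 < x := by simpa using hx
  rw [(hd x hx).deriv]
  have := hz_ineq m hm x hx
  nlinarith

lemma hz_two_monotone :
    MonotoneOn (fun x : ℝ => x ^ 2 * hz 2 x) (Set.Ioi 0) := by
  intro x hx y hy hxy
  have hx : 0 < x := hx
  have hy : 0 < y := hy
  simp only [hz]
  rw [← tsum_mul_left, ← tsum_mul_left]
  refine Summable.tsum_le_tsum (fun k => ?_) ((hz_summable 2 le_rfl x hx).mul_left _)
    ((hz_summable 2 le_rfl y hy).mul_left _)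
  rw [← div_eq_mul_inv, ← div_eq_mul_inv, ← div_pow, ← div_pow]
  gcongr 1
  rw [div_le_div_iff₀ (by positivity) (by positivity)]
  have : (0 : ℝ) ≤ k := by positivity
  nlinarith

noncomputable def hh (x : ℝ) : ℝ := ∑' k : ℕ, (((1 : ℝ) + k)⁻¹ - (x + k)⁻¹)

lemma hh_aux (x : ℝ) (hx : 0 < x) :
    Summable (fun k : ℕ => (((1 : ℝ) + k)⁻¹ - (x + k)⁻¹)) ∧ HasDerivAt hh (hz 2 x) x := by
  set a := min x 1 / 2 with ha
  have hm : 0 < min x 1 := lt_min hx one_pos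
  have ha0 : 0 < a := by linarith
  have hax : a < x := by have := min_le_left x 1; linarith
  have ha1 : a < 1 := by have := min_le_right x 1; linarith
  have hg : ∀ (k : ℕ) (y : ℝ), y ∈ Set.Ioi a →
      HasDerivAt (fun y : ℝ => (((1 : ℝ) + k)⁻¹ - (y + k)⁻¹)) (((y + k) ^ 2)⁻¹) y := by
    intro k y hy
    have := (inv_pow_hasDerivAt 1 k y (ha0.trans hy)).const_sub ((1 : ℝ) + k)⁻¹
    simpa using this
  have hg' : ∀ (k : ℕ) (y : ℝ), y ∈ Set.Ioi a →
      ‖((y + k) ^ 2)⁻¹‖ ≤ ((a + k) ^ 2)⁻¹ := by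
    intro k y hy
    have hy' : a < y := hy
    have : 0 < y := ha0.trans hy
    rw [Real.norm_of_nonneg (by positivity)]
    gcongr
  have hs := hz_summable 2 le_rfl a ha0
  have h1 : Summable (fun k : ℕ => (((1 : ℝ) + k)⁻¹ - ((1 : ℝ) + k)⁻¹)) := by
    simpa using summable_zero
  exact ⟨summable_of_summable_hasDerivAt_of_isPreconnected hs isOpen_Ioi isPreconnected_Ioi
      hg hg' (y₀ := 1) ha1 h1 hax,
    hasDerivAt_tsum_of_isPreconnected hs isOpen_Ioi isPreconnected_Ioi
      hg hg' (y₀ := 1) ha1 h1 hax⟩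

lemma hh_mono : MonotoneOn hh (Set.Ioi 0) := by
  intro x hx y hy hxy
  have hx : 0 < x := hx
  have hy : 0 < y := hy
  refine Summable.tsum_le_tsum (fun k => ?_) (hh_aux x hx).1 (hh_aux y hy).1
  gcongr

lemma hh_shift (x : ℝ) (hx : 0 < x) : hh (x + 1) = hh x + x⁻¹ := by
  have h1 := (hh_aux x hx).1
  have h2 := (hh_aux (x + 1) (by linarith)).1
  have e : hh (x + 1) - hh x = ∑' k : ℕ, ((x + k)⁻¹ - (x + (k + 1 : ℕ))⁻¹) := by
    unfold hh
    rw [← h2.tsum_sub h1]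
    congr 1
    ext k
    push_cast
    rw [show x + 1 + (k : ℝ) = x + (k + 1) by ring]
    ring
  have hsum : Summable (fun k : ℕ => ((x + k)⁻¹ - (x + (k + 1 : ℕ))⁻¹)) := by
    refine (h2.sub h1).congr fun k => ?_
    push_cast
    rw [show x + 1 + (k : ℝ) = x + (k + 1) by ring]
    ring
  have ht := hsum.hasSum.tendsto_sum_nat
  simp only [Finset.sum_range_sub' (fun k : ℕ => (x + (k : ℝ))⁻¹)] at ht
  have hl : Filter.Tendsto (fun n : ℕ => (x + ((0 : ℕ) : ℝ))⁻¹ - (x + (n : ℝ))⁻¹)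
      Filter.atTop (nhds (x⁻¹ - 0)) := by
    simp only [Nat.cast_zero, add_zero]
    exact ((Filter.tendsto_atTop_add_const_left _ x
      tendsto_natCast_atTop_atTop).inv_tendsto_atTop).const_sub _
  have := tendsto_nhds_unique ht hl
  linarith

lemma lg_diff (x : ℝ) (hx : 0 < x) :
    DifferentiableAt ℝ (fun t => Real.log (Real.Gamma t)) x := by
  refine DifferentiableAt.log (Real.differentiableAt_Gamma fun m => ?_) (Real.Gamma_pos_of_pos hx).ne'
  have : (0 : ℝ) ≤ m := by positivity
  linarith

lemma psi_mono : MonotoneOn psi (Set.Ioi 0) :=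
  Real.convexOn_log_Gamma.monotoneOn_deriv fun x hx => lg_diff x hx

lemma psi_shift (x : ℝ) (hx : 0 < x) : psi (x + 1) = psi x + x⁻¹ := by
  unfold psi
  rw [← deriv_comp_add_const, ← Real.deriv_log,
    ← deriv_fun_add (lg_diff x hx) (Real.differentiableAt_log hx.ne')]
  apply Filter.EventuallyEq.deriv_eq
  filter_upwards [lt_mem_nhds hx] with y hy
  rw [Real.Gamma_add_one hy.ne', Real.log_mul hy.ne' (Real.Gamma_pos_of_pos hy).ne', add_comm]

lemma shift_iter (f : ℝ → ℝ) (hf : ∀ x, 0 < x → f (x + 1) = f x + x⁻¹) (x : ℝ) (hx : 0 < x)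
    (n : ℕ) : f (x + n) = f x + ∑ k ∈ Finset.range n, (x + k)⁻¹ := by
  induction n with
  | zero => simp
  | succ n ih =>
    rw [Finset.sum_range_succ, ← add_assoc, ← ih, ← hf _ (by positivity)]
    push_cast; rw [add_assoc]

lemma shift_bound (f : ℝ → ℝ) (hm : MonotoneOn f (Set.Ioi 0))
    (hf : ∀ x, 0 < x → f (x + 1) = f x + x⁻¹) (x y : ℝ) (hx : 0 < x) (hxy : x ≤ y)
    (M : ℕ) (hM : y ≤ x + M) : 0 ≤ f y - f x ∧ f y - f x ≤ M * x⁻¹ := by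
  have hy : 0 < y := hx.trans_le hxy
  refine ⟨sub_nonneg.2 (hm hx hy hxy), ?_⟩
  have h1 := hm hy (show x + M ∈ Set.Ioi (0 : ℝ) from by simp; positivity) hM
  rw [shift_iter f hf x hx M] at h1
  have h2 : ∑ k ∈ Finset.range M, (x + k)⁻¹ ≤ M * x⁻¹ := by
    have := Finset.sum_le_card_nsmul (Finset.range M) (fun k : ℕ => (x + (k : ℝ))⁻¹) x⁻¹
      (fun k _ => by gcongr; simp)
    simpa using this
  linarith

lemma psi_sub_const (x y : ℝ) (hx : 0 < x) (hxy : x ≤ y) : psi y - psi x = hh y - hh x := by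
  obtain ⟨M, hM⟩ := exists_nat_ge (y - x)
  have hy : 0 < y := hx.trans_le hxy
  have key : ∀ n : ℕ, |(psi y - psi x) - (hh y - hh x)| ≤ M * (x + n)⁻¹ := by
    intro n
    obtain ⟨a, b⟩ := shift_bound psi psi_mono psi_shift (x + n) (y + n) (by positivity)
      (by linarith) M (by linarith)
    obtain ⟨c, d⟩ := shift_bound hh hh_mono hh_shift (x + n) (y + n) (by positivity)
      (by linarith) M (by linarith)
    rw [shift_iter psi psi_shift x hx, shift_iter psi psi_shift y hy] at a b
    rw [shift_iter hh hh_shift x hx, shift_iter hh hh_shift y hy] at c d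
    rw [abs_le]
    constructor <;> linarith
  have lim : Filter.Tendsto (fun n : ℕ => (M : ℝ) * (x + n)⁻¹) Filter.atTop (nhds (M * 0)) :=
    ((Filter.tendsto_atTop_add_const_left _ x
      tendsto_natCast_atTop_atTop).inv_tendsto_atTop).const_mul _
  rw [mul_zero] at lim
  have := ge_of_tendsto' lim key
  have := abs_nonpos_iff.1 this
  linarith

lemma psi_eq (x : ℝ) (hx : 0 < x) : psi x = hh x + (psi 1 - hh 1) := by
  rcases le_total x 1 with h | h
  · have := psi_sub_const x 1 hx h; linarith
  · have := psi_sub_const 1 x one_pos h; linarith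

lemma polygamma_zero_deriv (x : ℝ) (hx : 0 < x) : HasDerivAt (polygamma 0) (hz 2 x) x := by
  have h := (hh_aux x hx).2.add_const (psi 1 - hh 1)
  refine h.congr_of_eventuallyEq ?_
  filter_upwards [lt_mem_nhds hx] with y hy
  simpa [polygamma] using psi_eq y hy

lemma polygamma_succ_eq (n : ℕ) : ∀ x : ℝ, 0 < x →
    polygamma (n + 1) x = (-1) ^ n * (n + 1).factorial * hz (n + 2) x := by
  induction n with
  | zero =>
    intro x hx
    have := (polygamma_zero_deriv x hx).deriv
    rw [polygamma, iteratedDeriv_succ]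
    rw [polygamma] at this
    rw [this]; simp
  | succ n ih =>
    intro x hx
    rw [polygamma, iteratedDeriv_succ]
    have h : iteratedDeriv (n + 1) psi =ᶠ[nhds x]
        fun x => (-1) ^ n * (n + 1).factorial * hz (n + 2) x := by
      filter_upwards [lt_mem_nhds hx] with y hy using ih y hy
    rw [h.deriv_eq, ((hz_hasDerivAt (n + 2) (by omega) x hx).const_mul _).deriv]
    rw [Nat.factorial_succ (n + 1)]
    push_cast
    ring

lemma polygamma_succ_deriv (n : ℕ) (x : ℝ) (hx : 0 < x) :
    HasDerivAt (polygamma (n + 1))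
      ((-1) ^ n * (n + 1).factorial * (-((n + 2 : ℕ) : ℝ) * hz (n + 3) x)) x := by
  refine ((hz_hasDerivAt (n + 2) (by omega) x hx).const_mul _).congr_of_eventuallyEq ?_
  filter_upwards [lt_mem_nhds hx] with y hy using polygamma_succ_eq n y hy

lemma mean_lt (f f' : ℝ → ℝ) (hf : ∀ x, 0 < x → HasDerivAt f (f' x) x)
    (hq : MonotoneOn (fun x => x ^ 2 * f' x) (Set.Ioi 0)) (s t : ℝ) (hs : 0 < s) (hst : s < t) :
    f ((t - s) / (Real.log t - Real.log s)) ≤ (1 / (t - s)) * ∫ u in s..t, f u := by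
  have ht : 0 < t := hs.trans hst
  have hlog : 0 < Real.log t - Real.log s := sub_pos.2 (Real.log_lt_log hs hst)
  set L := (t - s) / (Real.log t - Real.log s) with hL
  have hd : 0 < t - s := sub_pos.2 hst
  have hLpos : 0 < L := div_pos hd hlog
  set c := L ^ 2 * f' L with hc
  have hphi : ∀ x, 0 < x → HasDerivAt (fun u => f u + c * u⁻¹) (f' x - c / x ^ 2) x := by
    intro x hx
    refine ((hf x hx).add ((hasDerivAt_inv hx.ne').const_mul c)).congr_deriv ?_
    ring
  have hsign : ∀ x, 0 < x → f' x - c / x ^ 2 = (x ^ 2 * f' x - c) / x ^ 2 := by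
    intro x hx; field_simp
  have tang : ∀ u, 0 < u → f L + c * L⁻¹ ≤ f u + c * u⁻¹ := by
    intro u hu
    rcases le_total L u with h | h
    · have : MonotoneOn (fun u => f u + c * u⁻¹) (Set.Ici L) := by
        refine monotoneOn_of_deriv_nonneg (convex_Ici L)
          (fun x hx => (hphi x (hLpos.trans_le hx)).continuousAt.continuousWithinAt)
          (fun x hx => ?_) (fun x hx => ?_) <;> rw [interior_Ici] at hx
        · exact (hphi x (hLpos.trans hx)).differentiableAt.differentiableWithinAt
        · have hx0 : 0 < x := hLpos.trans hx
          rw [(hphi x hx0).deriv, hsign x hx0]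
          exact div_nonneg (sub_nonneg.2 (hq hLpos hx0 (le_of_lt hx))) (by positivity)
      exact this (by simp) h h
    · have : AntitoneOn (fun u => f u + c * u⁻¹) (Set.Icc u L) := by
        refine antitoneOn_of_deriv_nonpos (convex_Icc u L)
          (fun x hx => (hphi x (hu.trans_le hx.1)).continuousAt.continuousWithinAt)
          (fun x hx => ?_) (fun x hx => ?_) <;> rw [interior_Icc] at hx
        · exact (hphi x (hu.trans hx.1)).differentiableAt.differentiableWithinAt
        · have hx0 : 0 < x := hu.trans hx.1
          rw [(hphi x hx0).deriv, hsign x hx0]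
          exact div_nonpos_of_nonpos_of_nonneg
            (sub_nonpos.2 (hq hx0 hLpos (le_of_lt hx.2))) (by positivity)
      exact this ⟨le_rfl, h⟩ ⟨h, le_rfl⟩ h
  have hfc : IntervalIntegrable f MeasureTheory.volume s t := by
    refine ContinuousOn.intervalIntegrable fun x hx => ?_
    rw [Set.uIcc_of_le hst.le] at hx
    exact (hf x (hs.trans_le hx.1)).continuousAt.continuousWithinAt
  have h0 : (0 : ℝ) ∉ Set.uIcc s t := by
    rw [Set.uIcc_of_le hst.le]; exact fun h => absurd h.1 (not_le.2 hs)
  have hic : IntervalIntegrable (fun u : ℝ => c * u⁻¹) MeasureTheory.volume s t := by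
    refine ContinuousOn.intervalIntegrable fun x hx => ?_
    rw [Set.uIcc_of_le hst.le] at hx
    exact (continuousAt_const.mul
      (continuousAt_inv₀ (hs.trans_le hx.1).ne')).continuousWithinAt
  have hint : ∫ _u in s..t, (f L + c * L⁻¹) ≤ ∫ u in s..t, (f u + c * u⁻¹) := by
    refine intervalIntegral.integral_mono_on hst.le (by simp) (hfc.add hic) fun x hx => ?_
    exact tang x (hs.trans_le hx.1)
  rw [intervalIntegral.integral_add hfc hic, intervalIntegral.integral_const,
    intervalIntegral.integral_const_mul, integral_inv h0, Real.log_div ht.ne' hs.ne',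
    smul_eq_mul] at hint
  have e : (t - s) * L⁻¹ = Real.log t - Real.log s := by
    rw [hL]; field_simp
  have e2 : (t - s) * (f L + c * L⁻¹) = (t - s) * f L + c * (Real.log t - Real.log s) := by
    rw [← e]; ring
  rw [e2] at hint
  rw [one_div, inv_mul_eq_div, le_div_iff₀ hd]
  linarith

lemma mean_ne (f f' : ℝ → ℝ) (hf : ∀ x, 0 < x → HasDerivAt f (f' x) x)
    (hq : MonotoneOn (fun x => x ^ 2 * f' x) (Set.Ioi 0)) (s t : ℝ) (hs : 0 < s) (ht : 0 < t)
    (hst : s ≠ t) :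
    f ((t - s) / (Real.log t - Real.log s)) ≤ (1 / (t - s)) * ∫ u in s..t, f u := by
  rcases lt_or_gt_of_ne hst with h | h
  · exact mean_lt f f' hf hq s t hs h
  · have := mean_lt f f' hf hq t s ht h
    rw [intervalIntegral.integral_symm, ← neg_sub s t, ← neg_sub (Real.log s), neg_div_neg_eq,
      one_div, inv_neg, neg_mul_neg, ← one_div]
    exact this

theorem stmt_15 (s t : ℝ) (hs : 0 < s) (ht : 0 < t) (hst : s ≠ t) (i : ℕ) :
    ((i = 0 ∨ Odd i) →
      polygamma i ((t - s) / (Real.log t - Real.log s)) ≤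
        (1 / (t - s)) * ∫ u in s..t, polygamma i u) ∧
    ((0 < i ∧ Even i) →
      (1 / (t - s)) * ∫ u in s..t, polygamma i u ≤
        polygamma i ((t - s) / (Real.log t - Real.log s))) := by
  constructor
  · intro hi
    rcases i with _ | n
    · exact mean_ne _ _ polygamma_zero_deriv hz_two_monotone s t hs ht hst
    · have hn : Even n := by
        rcases hi with h | h
        · omega
        · simpa [Nat.odd_add_one] using h
      refine mean_ne _ _ (polygamma_succ_deriv n) ?_ s t hs ht hst
      intro x hx y hy hxy
      have := hz_antitone (n + 3) (by omega) hx hy hxy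
      simp only [hn.neg_one_pow, one_mul] at this ⊢
      have hC : (0 : ℝ) ≤ (n + 1).factorial * ((n + 2 : ℕ) : ℝ) := by positivity
      have := mul_le_mul_of_nonneg_left this hC
      linarith
  · rintro ⟨h0, hi⟩
    rcases i with _ | n
    · omega
    · have hn : Odd n := by
        rw [Nat.even_add_one] at hi
        simpa using hi
      have := mean_ne (fun x => - polygamma (n + 1) x) _
        (fun x hx => (polygamma_succ_deriv n x hx).neg) ?_ s t hs ht hst
      · rw [intervalIntegral.integral_neg] at this
        linarith
      intro x hx y hy hxy
      have := hz_antitone (n + 3) (by omega) hx hy hxy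
      simp only [hn.neg_one_pow] at this ⊢
      have hC : (0 : ℝ) ≤ (n + 1).factorial * ((n + 2 : ℕ) : ℝ) := by positivity
      have := mul_le_mul_of_nonneg_left this hC
      linarith
end

section
/- For distinct positive real numbers s and t and a nonnegative integer i, if p ≤ -i-1 and q ≥ -i then (-1)^i·ψ^(i)(L_p(s,t)) ≤ (-1)^i·(1/(t-s))·∫ₛᵗ ψ^(i)(u) du ≤ (-1)^i·ψ^(i)(L_q(s,t)). -/
noncomputable def genLogMean (p a b : ℝ) : ℝ :=
  if p = -1 then (b - a) / (Real.log b - Real.log a)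
  else if p = 0 then (1 / Real.exp 1) * (b ^ b / a ^ a) ^ (1 / (b - a))
  else ((b ^ (p + 1) - a ^ (p + 1)) / ((p + 1) * (b - a))) ^ (1 / p)

noncomputable def phi (p u : ℝ) : ℝ := if p = 0 then Real.log u else u ^ p / p

lemma phi_hasDerivAt (p u : ℝ) (hu : 0 < u) : HasDerivAt (phi p) (u ^ (p - 1)) u := by
  by_cases hp : p = 0
  · subst hp
    have : phi 0 = Real.log := by funext x; simp [phi]
    rw [this]
    have h := Real.hasDerivAt_log hu.ne'
    rw [zero_sub, Real.rpow_neg_one]; exact h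
  · have : phi p = fun x => x ^ p / p := by funext x; simp [phi, hp]
    rw [this]
    have h := (Real.hasDerivAt_rpow_const (x := u) (p := p) (Or.inl hu.ne')).div_const p
    refine h.congr_deriv ?_
    field_simp

lemma tangent (F F' : ℝ → ℝ) (p : ℝ) (hF : ∀ x, 0 < x → HasDerivAt F (F' x) x)
    (hR : AntitoneOn (fun u => F' u * u ^ (1 - p)) (Set.Ioi 0)) (L u : ℝ) (hL : 0 < L) (hu : 0 < u) :
    F u ≤ F L + F' L * L ^ (1 - p) * (phi p u - phi p L) := by
  set c := F' L * L ^ (1 - p) with hc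
  have hD : ∀ x, 0 < x → HasDerivAt (fun x => F x - c * phi p x)
      (x ^ (p - 1) * (F' x * x ^ (1 - p) - c)) x := by
    intro x hx
    refine ((hF x hx).sub ((phi_hasDerivAt p x hx).const_mul c)).congr_deriv ?_
    have : x ^ (p - 1) * x ^ (1 - p) = 1 := by
      rw [← Real.rpow_add hx]; simp
    linear_combination -F' x * this
  suffices h : F u - c * phi p u ≤ F L - c * phi p L by linarith
  rcases le_total L u with h | h
  · have : AntitoneOn (fun x => F x - c * phi p x) (Set.Ici L) := by
      apply antitoneOn_of_deriv_nonpos (convex_Ici L)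
      · intro x hx; exact (hD x (hL.trans_le hx)).continuousAt.continuousWithinAt
      · intro x hx; rw [interior_Ici] at hx
        exact (hD x (hL.trans hx)).differentiableAt.differentiableWithinAt
      · intro x hx; rw [interior_Ici] at hx
        have hx0 : 0 < x := hL.trans hx
        rw [(hD x hx0).deriv]
        apply mul_nonpos_of_nonneg_of_nonpos (Real.rpow_nonneg hx0.le _)
        have := hR (a := L) (b := x) hL hx0 (le_of_lt hx)
        simp only at this
        linarith
    exact this (Set.self_mem_Ici) h h
  · have : MonotoneOn (fun x => F x - c * phi p x) (Set.Icc u L) := by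
      apply monotoneOn_of_deriv_nonneg (convex_Icc u L)
      · intro x hx; exact (hD x (hu.trans_le hx.1)).continuousAt.continuousWithinAt
      · intro x hx; rw [interior_Icc] at hx
        exact (hD x (hu.trans hx.1)).differentiableAt.differentiableWithinAt
      · intro x hx; rw [interior_Icc] at hx
        have hx0 : 0 < x := hu.trans hx.1
        rw [(hD x hx0).deriv]
        apply mul_nonneg (Real.rpow_nonneg hx0.le _)
        have := hR (a := x) (b := L) hx0 hL (le_of_lt hx.2)
        simp only at this
        linarith
    exact this ⟨le_refl _, h⟩ ⟨h, le_refl _⟩ h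

lemma uIcc_pos {s t x : ℝ} (hs : 0 < s) (ht : 0 < t) (hx : x ∈ Set.uIcc s t) : 0 < x :=
  lt_of_lt_of_le (lt_min hs ht) hx.1

lemma intble {s t : ℝ} (hs : 0 < s) (ht : 0 < t) {f : ℝ → ℝ}
    (hf : ∀ x, 0 < x → ContinuousAt f x) : IntervalIntegrable f MeasureTheory.volume s t :=
  ContinuousOn.intervalIntegrable fun x hx => (hf x (uIcc_pos hs ht hx)).continuousWithinAt

lemma mean_mono {s t : ℝ} (hs : 0 < s) (ht : 0 < t) (hst : s ≠ t) {f g : ℝ → ℝ}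
    (hf : ∀ x, 0 < x → ContinuousAt f x) (hg : ∀ x, 0 < x → ContinuousAt g x)
    (h : ∀ x, 0 < x → f x ≤ g x) :
    (1 / (t - s)) * ∫ u in s..t, f u ≤ (1 / (t - s)) * ∫ u in s..t, g u := by
  rcases lt_or_gt_of_ne hst with h1 | h1
  · apply mul_le_mul_of_nonneg_left
    · exact intervalIntegral.integral_mono_on h1.le (intble hs ht hf) (intble hs ht hg)
        fun x hx => h x (hs.trans_le hx.1)
    · have : 0 < t - s := by linarith
      positivity
  · apply mul_le_mul_of_nonpos_left
    · rw [intervalIntegral.integral_symm t s, intervalIntegral.integral_symm t s]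
      apply neg_le_neg
      exact intervalIntegral.integral_mono_on h1.le (intble ht hs hf) (intble ht hs hg)
        fun x hx => h x (ht.trans_le hx.1)
    · apply le_of_lt; rw [one_div]; exact inv_lt_zero.mpr (by linarith)

lemma mean_pos {s t : ℝ} (hs : 0 < s) (ht : 0 < t) (hst : s ≠ t) (p : ℝ) :
    0 < (1 / (t - s)) * ∫ u in s..t, u ^ p := by
  have key : ∀ a b : ℝ, 0 < a → a < b → 0 < ∫ u in a..b, u ^ p := by
    intro a b ha hab
    have hb := ha.trans hab
    apply intervalIntegral.intervalIntegral_pos_of_pos_on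
    · exact intble ha hb fun x hx => Real.continuousAt_rpow_const _ _ (Or.inl hx.ne')
    · intro x hx; exact Real.rpow_pos_of_pos (ha.trans hx.1) _
    · exact hab
  rcases lt_or_gt_of_ne hst with h1 | h1
  · have := key s t hs h1
    have : 0 < t - s := by linarith
    positivity
  · have := key t s ht h1
    rw [intervalIntegral.integral_symm t s]
    apply mul_pos_of_neg_of_neg
    · rw [one_div]; exact inv_lt_zero.mpr (by linarith)
    · linarith

lemma not_mem {s t : ℝ} (hs : 0 < s) (ht : 0 < t) : (0:ℝ) ∉ Set.uIcc s t := fun h =>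
  lt_irrefl _ (uIcc_pos hs ht h)

lemma genLogMean_spec' {s t : ℝ} (hs : 0 < s) (ht : 0 < t) (hst : s ≠ t) (p : ℝ) (hp : p ≠ 0) :
    genLogMean p s t = ((1 / (t - s)) * ∫ u in s..t, u ^ p) ^ (1 / p) := by
  have h0 : t - s ≠ 0 := sub_ne_zero.mpr hst.symm
  by_cases h1 : p = -1
  · have : ∫ u in s..t, u ^ p = Real.log t - Real.log s := by
      rw [h1]; simp_rw [Real.rpow_neg_one]
      rw [integral_inv (not_mem hs ht), Real.log_div ht.ne' hs.ne']
    rw [this]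
    simp only [genLogMean, h1, if_true]
    norm_num [Real.rpow_neg_one]
    field_simp
  · rw [integral_rpow (Or.inr ⟨h1, not_mem hs ht⟩)]
    simp only [genLogMean, h1, hp, if_false]
    congr 1
    have : p + 1 ≠ 0 := fun h => h1 (by linarith)
    field_simp

lemma genLogMean_pos {s t : ℝ} (hs : 0 < s) (ht : 0 < t) (hst : s ≠ t) (p : ℝ) :
    0 < genLogMean p s t := by
  by_cases hp : p = 0
  · subst hp
    simp only [genLogMean]
    norm_num
    have := Real.rpow_pos_of_pos hs s
    have := Real.rpow_pos_of_pos ht t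
    positivity
  · rw [genLogMean_spec' hs ht hst p hp]
    exact Real.rpow_pos_of_pos (mean_pos hs ht hst p) _

lemma genLogMean_spec {s t : ℝ} (hs : 0 < s) (ht : 0 < t) (hst : s ≠ t) (p : ℝ) :
    (1 / (t - s)) * ∫ u in s..t, phi p u = phi p (genLogMean p s t) := by
  have h0 : t - s ≠ 0 := sub_ne_zero.mpr hst.symm
  by_cases hp : p = 0
  · subst hp
    have h1 := Real.rpow_pos_of_pos hs s
    have h2 := Real.rpow_pos_of_pos ht t
    simp only [genLogMean, phi, if_true, integral_log]
    norm_num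
    rw [Real.log_mul (by positivity) (by positivity), Real.log_inv, Real.log_exp,
      Real.log_rpow (by positivity), Real.log_div (by positivity) (by positivity),
      Real.log_rpow hs, Real.log_rpow ht]
    field_simp
    ring
  · have e : phi p = fun x => x ^ p / p := by funext x; simp [phi, hp]
    rw [e, genLogMean_spec' hs ht hst p hp]
    simp only
    rw [← Real.rpow_mul (mean_pos hs ht hst p).le, one_div_mul_cancel hp, Real.rpow_one,
      intervalIntegral.integral_div]
    ring

lemma jensen (F F' : ℝ → ℝ) (p : ℝ) (hF : ∀ x, 0 < x → HasDerivAt F (F' x) x)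
    (hR : AntitoneOn (fun u => F' u * u ^ (1 - p)) (Set.Ioi 0)) {s t : ℝ}
    (hs : 0 < s) (ht : 0 < t) (hst : s ≠ t) :
    (1 / (t - s)) * ∫ u in s..t, F u ≤ F (genLogMean p s t) := by
  have h0 : t - s ≠ 0 := sub_ne_zero.mpr hst.symm
  set L := genLogMean p s t with hLdef
  have hL : 0 < L := genLogMean_pos hs ht hst p
  have cphi : ∀ x, 0 < x → ContinuousAt (phi p) x := fun x hx => (phi_hasDerivAt p x hx).continuousAt
  set c := F' L * L ^ (1 - p) with hc
  have h := mean_mono (f := F) (g := fun u => F L + c * (phi p u - phi p L)) hs ht hst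
    (fun x hx => (hF x hx).continuousAt)
    (fun x hx => continuousAt_const.add (continuousAt_const.mul ((cphi x hx).sub continuousAt_const)))
    (fun x hx => tangent F F' p hF hR L x hL hx)
  refine h.trans (le_of_eq ?_)
  have spec := genLogMean_spec hs ht hst p
  rw [← hLdef] at spec
  have i1 := intble hs ht cphi
  rw [intervalIntegral.integral_add (by simp) ((i1.sub (by simp)).const_mul c),
    intervalIntegral.integral_const_mul, intervalIntegral.integral_sub i1 (by simp)]
  rw [← spec]
  simp only [intervalIntegral.integral_const, smul_eq_mul]
  field_simp
  ring

open Filter Topology in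
lemma summable_bd (j : ℕ) (C : ℝ) (hj : 1 ≤ j) : Summable (fun k : ℕ => C * (((k : ℝ) + 1) ^ (j + 1))⁻¹) := by
  apply Summable.mul_left
  have h := (summable_nat_add_iff 1).mpr (Real.summable_nat_pow_inv (p := j + 1) |>.mpr (by omega))
  simpa using h

noncomputable def TT (j N : ℕ) (x : ℝ) : ℝ :=
  (if j = 0 then Real.log N else 0) -
    (-1) ^ j * (j.factorial : ℝ) * ∑ m ∈ Finset.range (N + 1), ((x + m) ^ (j + 1))⁻¹

lemma lower_bd {x : ℝ} (hx : 0 < x) {y : ℝ} (hy : y ∈ Set.Ioo (x / 2) (x + 1)) (k : ℕ) :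
    0 < min (x / 2) 1 * ((k : ℝ) + 1) ∧ min (x / 2) 1 * ((k : ℝ) + 1) ≤ y + k := by
  have h1 : min (x / 2) 1 ≤ x / 2 := min_le_left _ _
  have h2 : min (x / 2) 1 ≤ 1 := min_le_right _ _
  have h3 : 0 < min (x / 2) 1 := lt_min (by linarith) one_pos
  have hk : (0 : ℝ) ≤ k := Nat.cast_nonneg k
  refine ⟨by positivity, ?_⟩
  have := hy.1
  nlinarith

open Filter Topology in
lemma log_part : ∃ c, Tendsto (fun N : ℕ => Real.log N - ∑ k ∈ Finset.range (N + 1), ((k : ℝ) + 1)⁻¹)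
    atTop (𝓝 c) := by
  refine ⟨-Real.eulerMascheroniConstant - 0, ?_⟩
  have h := Real.tendsto_harmonic_sub_log.neg.sub
    (tendsto_one_div_add_atTop_nhds_zero_nat (𝕜 := ℝ))
  refine h.congr fun N => ?_
  rw [Finset.sum_range_succ, harmonic]
  push_cast
  ring

open Filter Topology in
lemma TT_unif (j : ℕ) : ∃ g : ℝ → ℝ, TendstoLocallyUniformlyOn (TT j) g atTop (Set.Ioi 0) := by
  have nb : ∀ x : ℝ, 0 < x → Set.Ioo (x / 2) (x + 1) ∈ 𝓝[Set.Ioi 0] x := fun x hx =>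
    mem_nhdsWithin_of_mem_nhds (Ioo_mem_nhds (by linarith) (by linarith))
  by_cases hj : j = 0
  · subst hj
    obtain ⟨c, hc⟩ := log_part
    refine ⟨fun x => c + ∑' k : ℕ, (((k : ℝ) + 1)⁻¹ - (x + k)⁻¹), ?_⟩
    apply tendstoLocallyUniformlyOn_of_forall_exists_nhds
    intro x hx
    have hx : 0 < x := hx
    refine ⟨_, nb x hx, ?_⟩
    have h1 := tendstoUniformlyOn_tsum_nat (f := fun (k : ℕ) (y : ℝ) => (((k : ℝ) + 1)⁻¹ - (y + k)⁻¹))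
      (summable_bd 1 ((x + 2) / min (x / 2) 1) le_rfl) (s := Set.Ioo (x / 2) (x + 1)) (by
        intro k y hy
        obtain ⟨h1, h2⟩ := lower_bd hx hy k
        have h3 : 0 < min (x / 2) 1 := lt_min (by linarith) one_pos
        have hk : (0 : ℝ) < (k : ℝ) + 1 := by positivity
        have hyk : 0 < y + k := h1.trans_le h2
        have e : ((k : ℝ) + 1)⁻¹ - (y + k)⁻¹ = (y - 1) * (((k : ℝ) + 1)⁻¹ * (y + k)⁻¹) := by
          field_simp; ring
        rw [e, Real.norm_eq_abs, abs_mul, abs_of_pos (a := ((k : ℝ) + 1)⁻¹ * (y + k)⁻¹) (by positivity)]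
        have e2 : (x + 2) / min (x / 2) 1 * (((k : ℝ) + 1) ^ (1 + 1))⁻¹ =
            (x + 2) * (((k : ℝ) + 1)⁻¹ * (min (x / 2) 1 * ((k : ℝ) + 1))⁻¹) := by
          field_simp
        rw [e2]
        have : |y - 1| ≤ x + 2 := by
          rw [abs_le]; constructor <;> linarith [hy.1, hy.2]
        gcongr)
    have h2 : TendstoUniformlyOn (fun (N : ℕ) (_ : ℝ) => Real.log N - ∑ k ∈ Finset.range (N + 1), ((k : ℝ) + 1)⁻¹)
        (fun _ => c) atTop (Set.Ioo (x / 2) (x + 1)) := hc.tendstoUniformlyOn_const _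
    have h3 : TendstoUniformlyOn (fun (N : ℕ) (y : ℝ) => ∑ k ∈ Finset.range (N + 1), (((k : ℝ) + 1)⁻¹ - (y + k)⁻¹))
        (fun y : ℝ => ∑' k : ℕ, (((k : ℝ) + 1)⁻¹ - (y + k)⁻¹)) atTop (Set.Ioo (x / 2) (x + 1)) := fun u hu =>
      (tendsto_add_atTop_nat 1).eventually (h1 u hu)
    refine (h2.add h3).congr (Eventually.of_forall fun N y _ => ?_)
    simp only [TT, Pi.add_apply, Finset.sum_sub_distrib]
    simp
  · refine ⟨fun x => ∑' k : ℕ, (-((-1) ^ j * (j.factorial : ℝ) * ((x + k) ^ (j + 1))⁻¹)), ?_⟩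
    apply tendstoLocallyUniformlyOn_of_forall_exists_nhds
    intro x hx
    have hx : 0 < x := hx
    refine ⟨_, nb x hx, ?_⟩
    have h1 := tendstoUniformlyOn_tsum_nat
      (f := fun (k : ℕ) (y : ℝ) => (-((-1) ^ j * (j.factorial : ℝ) * ((y + k) ^ (j + 1))⁻¹)))
      (summable_bd j (j.factorial * ((min (x / 2) 1) ^ (j + 1))⁻¹) (by omega))
      (s := Set.Ioo (x / 2) (x + 1)) (by
        intro k y hy
        obtain ⟨h1, h2⟩ := lower_bd hx hy k
        have hyk : 0 < y + k := h1.trans_le h2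
        rw [norm_neg, norm_mul, norm_mul, norm_pow, norm_neg, norm_one, one_pow, one_mul,
          Real.norm_of_nonneg (by positivity), Real.norm_of_nonneg (by positivity), mul_assoc,
          ← mul_inv, ← mul_pow]
        gcongr)
    have h3 : TendstoUniformlyOn (fun (N : ℕ) (y : ℝ) => ∑ k ∈ Finset.range (N + 1),
        (-((-1) ^ j * (j.factorial : ℝ) * ((y + k) ^ (j + 1))⁻¹))) 
        (fun x : ℝ => ∑' k : ℕ, (-((-1) ^ j * (j.factorial : ℝ) * ((x + k) ^ (j + 1))⁻¹)))
        atTop (Set.Ioo (x / 2) (x + 1)) := fun u hu =>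
      (tendsto_add_atTop_nat 1).eventually (h1 u hu)
    refine h3.congr (Eventually.of_forall fun N y _ => ?_)
    simp only [TT, hj, if_false, Finset.sum_neg_distrib, ← Finset.mul_sum]
    ring

lemma TT_hasDerivAt (j N : ℕ) {x : ℝ} (hx : 0 < x) : HasDerivAt (TT j N) (TT (j + 1) N x) x := by
  have h : HasDerivAt (fun x : ℝ => ∑ m ∈ Finset.range (N + 1), ((x + m) ^ (j + 1))⁻¹)
      (∑ m ∈ Finset.range (N + 1), (-((j + 1 : ℕ) : ℝ) * ((x + m) ^ (j + 2))⁻¹)) x := by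
    apply HasDerivAt.fun_sum
    intro m _
    have hm : (0 : ℝ) < x + m := by positivity
    refine (HasDerivAt.fun_inv (((hasDerivAt_id' x).add_const (m : ℝ)).fun_pow (j + 1)) (by positivity)).congr_deriv ?_
    simp only [Nat.add_sub_cancel]
    field_simp
    ring
  refine ((h.const_mul ((-1) ^ j * (j.factorial : ℝ))).const_sub (if j = 0 then Real.log N else 0)).congr_deriv ?_
  simp only [TT, ← Finset.mul_sum, Nat.factorial_succ]
  push_cast
  simp
  ring

lemma lgs_hasDerivAt (N : ℕ) {x : ℝ} (hx : 0 < x) :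
    HasDerivAt (fun x => Real.BohrMollerup.logGammaSeq x N) (TT 0 N x) x := by
  have h : HasDerivAt (fun x : ℝ => ∑ m ∈ Finset.range (N + 1), Real.log (x + m))
      (∑ m ∈ Finset.range (N + 1), (x + m)⁻¹) x := by
    apply HasDerivAt.fun_sum
    intro m _
    have hm : (0 : ℝ) < x + m := by positivity
    refine (((hasDerivAt_id' x).add_const (m : ℝ)).log hm.ne').congr_deriv ?_
    simp
  refine ((((hasDerivAt_id' x).mul_const (Real.log N)).add_const (Real.log (N.factorial))).sub h).congr_deriv ?_
  simp [TT]

open Filter Topology in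
lemma polygamma_facts (j : ℕ) (x : ℝ) (hx : 0 < x) :
    HasDerivAt (polygamma j) (polygamma (j + 1) x) x ∧
    Tendsto (fun N => TT j N x) atTop (𝓝 (polygamma j x)) := by
  choose P hP using TT_unif
  have hPd : ∀ j x, 0 < x → HasDerivAt (P j) (P (j + 1) x) x := by
    intro j x hx
    exact hasDerivAt_of_tendstoLocallyUniformlyOn isOpen_Ioi (hP (j + 1))
      (Eventually.of_forall fun N y hy => TT_hasDerivAt j N hy)
      (fun y hy => (hP j).tendsto_at hy) hx
  have hG : ∀ x, 0 < x → HasDerivAt (fun t => Real.log (Real.Gamma t)) (P 0 x) x := by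
    intro x hx
    exact hasDerivAt_of_tendstoLocallyUniformlyOn isOpen_Ioi (hP 0)
      (Eventually.of_forall fun N y hy => lgs_hasDerivAt N hy)
      (fun y hy => Real.BohrMollerup.tendsto_log_gamma hy) hx
  have hE : ∀ j x, 0 < x → polygamma j x = P j x := by
    intro j
    induction j with
    | zero => intro x hx; simp only [polygamma, iteratedDeriv_zero, psi]; exact (hG x hx).deriv
    | succ j ih =>
      intro x hx
      have : polygamma (j + 1) x = deriv (polygamma j) x := by
        simp only [polygamma, iteratedDeriv_succ]
      rw [this]
      have he : polygamma j =ᶠ[𝓝 x] P j := by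
        filter_upwards [Ioi_mem_nhds hx] with y hy using ih y hy
      rw [he.deriv_eq, (hPd j x hx).deriv]
  have he : polygamma j =ᶠ[𝓝 x] P j := by
    filter_upwards [Ioi_mem_nhds hx] with y hy using hE j y hy
  refine ⟨?_, ?_⟩
  · rw [hE (j + 1) x hx]
    exact (hPd j x hx).congr_of_eventuallyEq he
  · rw [hE j x hx]
    exact (hP j).tendsto_at hx

lemma bern (N : ℕ) (y : ℝ) (hy : 1 < y) : (y ^ N)⁻¹ + N * (y ^ (N + 1))⁻¹ ≤ ((y - 1) ^ N)⁻¹ := by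
  have h0 : 0 < y - 1 := by linarith
  have h := one_add_mul_le_pow (a := (y - 1)⁻¹) (by have : 0 < (y-1)⁻¹ := by positivity
                                                    linarith) N
  have e : 1 + (y - 1)⁻¹ = y / (y - 1) := by field_simp; ring
  rw [e, div_pow] at h
  have h2 : y⁻¹ ≤ (y - 1)⁻¹ := by gcongr; linarith
  have h3 : 1 + N * y⁻¹ ≤ y ^ N / (y - 1) ^ N := by
    have : (N : ℝ) * y⁻¹ ≤ N * (y - 1)⁻¹ := by gcongr
    linarith
  have h4 := mul_le_mul_of_nonneg_left h3 (show 0 ≤ (y ^ N)⁻¹ by positivity)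
  calc (y ^ N)⁻¹ + N * (y ^ (N + 1))⁻¹ = (y ^ N)⁻¹ * (1 + N * y⁻¹) := by rw [pow_succ, mul_inv]; ring
    _ ≤ _ := h4
    _ = _ := by field_simp

lemma brackets (n M : ℕ) (u : ℝ) (hu : 0 < u) :
    ∑ m ∈ Finset.range (M + 1), (n * ((u + m) ^ (n + 1))⁻¹ - (n + 1) * u * ((u + m) ^ (n + 2))⁻¹) ≤
      -((M : ℝ) + 1) * ((u + M) ^ (n + 1))⁻¹ := by
  have br : ∀ m : ℕ, n * ((u + m) ^ (n + 1))⁻¹ - (n + 1) * u * ((u + m) ^ (n + 2))⁻¹ =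
      - ((u + m) ^ (n + 1))⁻¹ + (n + 1) * m * ((u + m) ^ (n + 2))⁻¹ := by
    intro m
    have : 0 < u + m := by positivity
    rw [pow_succ _ (n + 1)]
    field_simp
    ring
  simp_rw [br]
  induction M with
  | zero => simp
  | succ M ih =>
    rw [Finset.sum_range_succ]
    have hM : (0 : ℝ) ≤ M := Nat.cast_nonneg M
    have b := bern (n + 1) (u + (M + 1 : ℕ)) (by push_cast; linarith)
    have e : u + ((M + 1 : ℕ) : ℝ) - 1 = u + M := by push_cast; ring
    rw [e] at b
    have b2 := mul_le_mul_of_nonneg_left b (show (0 : ℝ) ≤ M + 1 by positivity)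
    push_cast at b2 ih ⊢
    linarith

lemma B_anti (n N : ℕ) (hn : 1 ≤ n) :
    AntitoneOn (fun u : ℝ => u ^ n * ∑ m ∈ Finset.range (N + 1), ((u + m) ^ (n + 1))⁻¹) (Set.Ioi 0) := by
  have hD : ∀ u : ℝ, 0 < u → HasDerivAt
      (fun u : ℝ => u ^ n * ∑ m ∈ Finset.range (N + 1), ((u + m) ^ (n + 1))⁻¹)
      (u ^ (n - 1) * ∑ m ∈ Finset.range (N + 1),
        (n * ((u + m) ^ (n + 1))⁻¹ - (n + 1) * u * ((u + m) ^ (n + 2))⁻¹)) u := by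
    intro u hu
    have h : HasDerivAt (fun x : ℝ => ∑ m ∈ Finset.range (N + 1), ((x + m) ^ (n + 1))⁻¹)
        (∑ m ∈ Finset.range (N + 1), (-((n + 1 : ℕ) : ℝ) * ((u + m) ^ (n + 2))⁻¹)) u := by
      apply HasDerivAt.fun_sum
      intro m _
      have hm : (0 : ℝ) < u + m := by positivity
      refine (HasDerivAt.fun_inv (((hasDerivAt_id' u).add_const (m : ℝ)).fun_pow (n + 1)) (by positivity)).congr_deriv ?_
      simp only [Nat.add_sub_cancel]
      field_simp
      ring
    refine ((hasDerivAt_pow n u).mul h).congr_deriv ?_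
    obtain ⟨k, rfl⟩ : ∃ k, n = k + 1 := ⟨n - 1, by omega⟩
    simp only [Finset.sum_sub_distrib, ← Finset.mul_sum, Nat.add_sub_cancel]
    push_cast
    ring
  apply antitoneOn_of_deriv_nonpos (convex_Ioi 0)
  · intro x hx; exact (hD x hx).continuousAt.continuousWithinAt
  · intro x hx; rw [interior_Ioi] at hx; exact (hD x hx).differentiableAt.differentiableWithinAt
  · intro x hx; rw [interior_Ioi] at hx
    have hx : 0 < x := hx
    rw [(hD x hx).deriv]
    apply mul_nonpos_of_nonneg_of_nonpos (by positivity)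
    refine (brackets n N x hx).trans ?_
    rw [neg_mul, neg_nonpos]; positivity

lemma B_mono (n N : ℕ) :
    MonotoneOn (fun u : ℝ => u ^ (n + 1) * ∑ m ∈ Finset.range (N + 1), ((u + m) ^ (n + 1))⁻¹) (Set.Ioi 0) := by
  intro x hx y hy hxy
  have hx : 0 < x := hx
  have hy : 0 < y := hy
  simp only [Finset.mul_sum]
  apply Finset.sum_le_sum
  intro m _
  rw [← div_eq_mul_inv, ← div_eq_mul_inv, ← div_pow, ← div_pow]
  apply pow_le_pow_left₀ (by positivity)
  have hm : (0 : ℝ) ≤ m := Nat.cast_nonneg m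
  rw [div_le_div_iff₀ (by positivity) (by positivity)]
  nlinarith

open Filter Topology in
lemma F'_lim (i : ℕ) (x : ℝ) (hx : 0 < x) :
    Tendsto (fun N : ℕ => ((i + 1).factorial : ℝ) * ∑ m ∈ Finset.range (N + 1), ((x + m) ^ (i + 1 + 1))⁻¹)
      atTop (𝓝 ((-1) ^ i * polygamma (i + 1) x)) := by
  refine ((polygamma_facts (i + 1) x hx).2.const_mul ((-1) ^ i)).congr fun N => ?_
  have : ((-1 : ℝ) ^ i) * (-1) ^ i = 1 := by rw [← mul_pow]; simp
  simp only [TT, Nat.add_eq_zero_iff, one_ne_zero, and_false, if_false, pow_succ (-1 : ℝ) i]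
  linear_combination (((i + 1).factorial : ℝ) * ∑ m ∈ Finset.range (N + 1), ((x + m) ^ (i + 1 + 1))⁻¹) * this

lemma F'_nonneg (i : ℕ) (x : ℝ) (hx : 0 < x) : 0 ≤ (-1) ^ i * polygamma (i + 1) x :=
  ge_of_tendsto' (F'_lim i x hx) fun N => by positivity

lemma R_anti (i : ℕ) : AntitoneOn (fun u : ℝ => u ^ (i + 1) * ((-1) ^ i * polygamma (i + 1) u)) (Set.Ioi 0) := by
  intro x hx y hy hxy
  refine le_of_tendsto_of_tendsto' ((F'_lim i y hy).const_mul _) ((F'_lim i x hx).const_mul _) fun N => ?_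
  have h := mul_le_mul_of_nonneg_left (B_anti (i + 1) N (by omega) hx hy hxy)
    (show (0 : ℝ) ≤ ((i + 1).factorial : ℝ) by positivity)
  simp only at h
  linarith

lemma R_mono (i : ℕ) : MonotoneOn (fun u : ℝ => u ^ (i + 1 + 1) * ((-1) ^ i * polygamma (i + 1) u)) (Set.Ioi 0) := by
  intro x hx y hy hxy
  refine le_of_tendsto_of_tendsto' ((F'_lim i x hx).const_mul _) ((F'_lim i y hy).const_mul _) fun N => ?_
  have h := mul_le_mul_of_nonneg_left (B_mono (i + 1) N hx hy hxy)
    (show (0 : ℝ) ≤ ((i + 1).factorial : ℝ) by positivity)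
  simp only at h
  linarith

theorem stmt_19 (s t : ℝ) (hs : 0 < s) (ht : 0 < t) (hst : s ≠ t) (i : ℕ) (p q : ℝ)
    (hp : p ≤ -(i : ℝ) - 1) (hq : -(i : ℝ) ≤ q) :
    (-1 : ℝ) ^ i * polygamma i (genLogMean p s t) ≤
      (-1 : ℝ) ^ i * ((1 / (t - s)) * ∫ u in s..t, polygamma i u) ∧
    (-1 : ℝ) ^ i * ((1 / (t - s)) * ∫ u in s..t, polygamma i u) ≤
      (-1 : ℝ) ^ i * polygamma i (genLogMean q s t) := by
  have hF : ∀ x, 0 < x → HasDerivAt (fun x => (-1 : ℝ) ^ i * polygamma i x)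
      ((-1 : ℝ) ^ i * polygamma (i + 1) x) x := fun x hx => (polygamma_facts i x hx).1.const_mul _
  have split : ∀ (r : ℝ) (k : ℕ) (x : ℝ), 0 < x → x ^ (1 - r) = x ^ k * x ^ (1 - r - k) := by
    intro r k x hx
    rw [← Real.rpow_natCast, ← Real.rpow_add hx]
    congr 1; ring
  constructor
  · have h := jensen (fun x => -((-1 : ℝ) ^ i * polygamma i x))
      (fun x => -((-1 : ℝ) ^ i * polygamma (i + 1) x)) p (fun x hx => (hF x hx).neg) (by
        intro x hx y hy hxy
        have hx : 0 < x := hx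
        have hy : 0 < y := hy
        have h1 := R_mono i hx hy hxy
        have h2 : x ^ (1 - p - (i + 1 + 1 : ℕ)) ≤ y ^ (1 - p - (i + 1 + 1 : ℕ)) :=
          Real.rpow_le_rpow hx.le hxy (by push_cast; linarith)
        have h3 := mul_le_mul h1 h2 (Real.rpow_nonneg hx.le _)
          (mul_nonneg (by positivity) (F'_nonneg i y hy))
        simp only
        rw [split p (i + 1 + 1) x hx, split p (i + 1 + 1) y hy]
        linarith) hs ht hst
    simp only [intervalIntegral.integral_neg, intervalIntegral.integral_const_mul] at h
    linarith
  · have h := jensen (fun x => (-1 : ℝ) ^ i * polygamma i x)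
      (fun x => (-1 : ℝ) ^ i * polygamma (i + 1) x) q hF (by
        intro x hx y hy hxy
        have hx : 0 < x := hx
        have hy : 0 < y := hy
        have h1 := R_anti i hx hy hxy
        have h2 : y ^ (1 - q - (i + 1 : ℕ)) ≤ x ^ (1 - q - (i + 1 : ℕ)) :=
          Real.rpow_le_rpow_of_nonpos hx hxy (by push_cast; linarith)
        have h3 := mul_le_mul h1 h2 (Real.rpow_nonneg hy.le _)
          (mul_nonneg (by positivity) (F'_nonneg i x hx))
        simp only
        rw [split q (i + 1) x hx, split q (i + 1) y hy]
        linarith) hs ht hst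
    simp only [intervalIntegral.integral_const_mul] at h
    linarith
end
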